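/- Let I be a finite index set, m : I → ℝ with m_j > 0 for all j, and let f⁽¹⁾,…,f⁽⁷⁾ : I × I × I → ℂ satisfy, for all j,k,l ∈ I, the system (E1)–(E7): (E1) f⁽²⁾_{kjl}·m_l² + i·f⁽⁶⁾_{jkl}·m_j + f⁽²⁾_{ljk}·m_k² + i·f⁽⁶⁾_{jlk}·m_j = 0; (E2) −32·f⁽¹⁾_{jkl} + 2·f⁽²⁾_{kjl} + i·f⁽⁵⁾_{jkl}·m_j = 0; (E3) f⁽²⁾_{jkl} − i·f⁽³⁾_{kjl}·m_k = 0; (E4) f⁽²⁾_{kjl}·m_l + f⁽⁴⁾_{jlk}·m_j = 0; (E5) 2·f⁽³⁾_{jkl} + f⁽⁵⁾_{jkl} + 2i·f⁽⁷⁾_{jkl}·m_k = 0; (E6) f⁽³⁾_{jkl}·m_l² + i·f⁽⁴⁾_{jkl}·m_k + 2·f⁽⁶⁾_{jkl} = 0; (E7) i·f⁽³⁾_{jkl}·m_l + f⁽⁴⁾_{jlk} = 0. Then for all j,k,l ∈ I one has f⁽⁷⁾_{jkl} = (16/(m_j·m_k))·f⁽¹⁾_{jkl}. -/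

import Mathlib

theorem susy_gauge_stmt {I : Type*} [Fintype I] (m : I → ℝ) (hm : ∀ j, 0 < m j)
    (f1 f2 f3 f4 f5 f6 f7 : I → I → I → ℂ)
    (E1 : ∀ j k l : I, f2 k j l * (m l : ℂ)^2 + Complex.I * f6 j k l * (m j : ℂ)
        + f2 l j k * (m k : ℂ)^2 + Complex.I * f6 j l k * (m j : ℂ) = 0)
    (E2 : ∀ j k l : I, -32 * f1 j k l + 2 * f2 k j l + Complex.I * f5 j k l * (m j : ℂ) = 0)
    (E3 : ∀ j k l : I, f2 j k l - Complex.I * f3 k j l * (m k : ℂ) = 0)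
    (E4 : ∀ j k l : I, f2 k j l * (m l : ℂ) + f4 j l k * (m j : ℂ) = 0)
    (E5 : ∀ j k l : I, 2 * f3 j k l + f5 j k l + 2 * Complex.I * f7 j k l * (m k : ℂ) = 0)
    (E6 : ∀ j k l : I, f3 j k l * (m l : ℂ)^2 + Complex.I * f4 j k l * (m k : ℂ) + 2 * f6 j k l = 0)
    (E7 : ∀ j k l : I, Complex.I * f3 j k l * (m l : ℂ) + f4 j l k = 0)
    :
    ∀ j k l : I, f7 j k l = (16 / ((m j : ℂ) * (m k : ℂ))) * f1 j k l := by
  intro j k l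
  have hj : (m j : ℂ) ≠ 0 := Complex.ofReal_ne_zero.mpr (hm j).ne'
  have hk : (m k : ℂ) ≠ 0 := Complex.ofReal_ne_zero.mpr (hm k).ne'
  rw [div_mul_eq_mul_div, eq_div_iff (mul_ne_zero hj hk)]
  linear_combination (1 / 2) * E2 j k l - E3 k j l - Complex.I / 2 * m j * E5 j k l
    + f7 j k l * m j * m k * Complex.I_sq
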